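/- arXiv:1506.00022 — 2 statements merged into one kernel-verified Lean document; each statement's English description precedes it below -/
import Mathlib

section
/- Fix natural numbers n and k with k ≥ 2, a simple graph G' on a vertex type of cardinality n, and a fixed edge pattern s assigning a Boolean to each non-consecutive pair {i,j} of Fin k (i.e., pairs with j ≠ i+1 and i ≠ j+1). Let m = C(k,2) − (k−1) be the number of such non-consecutive pairs. If w is chosen uniformly at random among all assignments of Booleans to the non-consecutive pairs, then the probability that there exists an injective map f : Fin k → V(G') such that (a) for every non-consecutive pair {i,j}, f i and f j are adjacent in G' if and only if s{i,j} XOR w{i,j} is true, and (b) for every i < k−1, f i and f (i+1) are adjacent in G', is at most n^k · 2^{−m}. -/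
open scoped ENNReal

/-- An unordered pair `{i, j}` of distinct elements of `Fin k`, represented with
`i < j`, that is non-consecutive: `j ≠ i+1` (and automatically `i ≠ j+1`). -/
abbrev NonConsecPair (k : ℕ) : Type :=
  {p : Fin k × Fin k // p.1.val < p.2.val ∧ p.2.val ≠ p.1.val + 1}

theorem card_lt_pairs (k : ℕ) :
    (Finset.univ.filter (fun p : Fin k × Fin k => p.1.val < p.2.val)).card = Nat.choose k 2 := by
  have h1 : (Finset.univ.filter (fun p : Fin k × Fin k => p.1.val < p.2.val)).card
      = ∑ j : Fin k, j.val := by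
    rw [Finset.card_filter, Fintype.sum_prod_type_right]
    refine Finset.sum_congr rfl fun j _ => ?_
    rw [← Finset.card_filter]
    have : (Finset.univ.filter (fun i : Fin k => i.val < j.val)) = Finset.Iio j := by
      ext i; simp
    rw [this, Fin.card_Iio]
  rw [h1, Fin.sum_univ_eq_sum_range (fun i => i) k, Finset.sum_range_id, Nat.choose_two_right]

theorem card_nonConsec (k : ℕ) :
    Nat.choose k 2 - (k - 1) ≤ Fintype.card (NonConsecPair k) := by
  have h2 : (Finset.univ.filter (fun p : Fin k × Fin k => p.2.val = p.1.val + 1)).card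
      ≤ k - 1 := by
    rw [← Finset.card_range (k - 1)]
    refine Finset.card_le_card_of_injOn (fun p => p.1.val) ?_ ?_
    · intro p hp
      simp at hp ⊢
      have := p.2.isLt
      omega
    · intro p hp q hq h
      simp at hp hq h
      ext
      · simp [h]
      · rw [hp, hq, h]
  have h3 : (Finset.univ.filter (fun p : Fin k × Fin k => p.1.val < p.2.val)) ⊆
      (Finset.univ.filter (fun p : Fin k × Fin k =>
        p.1.val < p.2.val ∧ p.2.val ≠ p.1.val + 1)) ∪
      (Finset.univ.filter (fun p : Fin k × Fin k => p.2.val = p.1.val + 1)) := by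
    intro p hp
    simp at hp ⊢
    tauto
  have h4 := (Finset.card_le_card h3).trans (Finset.card_union_le _ _)
  rw [card_lt_pairs] at h4
  rw [Fintype.card_subtype]
  omega

/-- Union bound for watermark detection: for a graph `G'` on `n` vertices and a fixed
pattern `s` on the non-consecutive pairs of `Fin k`, the probability over a uniformly
random assignment `w` of Booleans to the non-consecutive pairs that some injective
`f : Fin k → V` realizes the watermark (XOR-ed pattern on non-consecutive pairs,
edges on consecutive pairs) is at most `n^k * 2^{-m}` with `m = C(k,2) - (k-1)`. -/
theorem watermark_union_bound (n k : ℕ) (hk : 2 ≤ k)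
    (V : Type) [Fintype V] (hV : Fintype.card V = n)
    (G' : SimpleGraph V) (s : NonConsecPair k → Bool) :
    (PMF.uniformOfFintype (NonConsecPair k → Bool)).toOuterMeasure
      {w | ∃ f : Fin k → V, Function.Injective f ∧
        (∀ p : NonConsecPair k,
          G'.Adj (f p.val.1) (f p.val.2) ↔ xor (s p) (w p) = true) ∧
        (∀ i : ℕ, (h : i + 1 < k) →
          G'.Adj (f ⟨i, Nat.lt_of_succ_lt h⟩) (f ⟨i + 1, h⟩))}
      ≤ (n : ℝ≥0∞) ^ k * (1 / 2) ^ (Nat.choose k 2 - (k - 1)) := by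
  classical
  set g : (Fin k → V) → (NonConsecPair k → Bool) :=
    fun f p => xor (s p) (decide (G'.Adj (f p.val.1) (f p.val.2))) with hg
  set μ := (PMF.uniformOfFintype (NonConsecPair k → Bool)).toOuterMeasure with hμ
  calc _ ≤ μ (⋃ f : Fin k → V, {g f}) := by
        refine MeasureTheory.measure_mono ?_
        rintro w ⟨f, -, h, -⟩
        refine Set.mem_iUnion.2 ⟨f, ?_⟩
        rw [Set.mem_singleton_iff]
        funext p
        have hp := h p
        simp only [hg, hp]
        cases s p <;> cases w p <;> rfl
    _ ≤ ∑ f : Fin k → V, μ {g f} := MeasureTheory.measure_iUnion_fintype_le _ _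
    _ = ∑ f : Fin k → V, (1 / 2 : ℝ≥0∞) ^ Fintype.card (NonConsecPair k) := by
        refine Finset.sum_congr rfl fun f _ => ?_
        rw [hμ, PMF.toOuterMeasure_apply_singleton, PMF.uniformOfFintype_apply]
        simp [ENNReal.inv_pow]
    _ = (n : ℝ≥0∞) ^ k * (1 / 2) ^ Fintype.card (NonConsecPair k) := by
        simp [hV]
    _ ≤ _ := by
        refine mul_le_mul_right ?_ _
        exact pow_le_pow_of_le_one (by simp) (by simp) (card_nonConsec k)
end

section
/- Fix a real δ > 0, natural numbers n ≥ 2 and k ≥ 2 with (k : ℝ) ≥ (2+δ) · log₂ n, a simple graph G' on a vertex type of cardinality n, and a fixed edge pattern s assigning a Boolean to each non-consecutive pair {i,j} of Fin k. Let m = C(k,2) − (k−1). If w is chosen uniformly at random among all assignments of Booleans to the non-consecutive pairs, then the probability that there exists an injective map f : Fin k → V(G') such that (a) for every non-consecutive pair {i,j}, f i and f j are adjacent in G' if and only if s{i,j} XOR w{i,j} is true, and (b) for every i < k−1, f i and f (i+1) are adjacent in G', is at most 2^{−(δk²/(2(2+δ)) − 3k/2 + 1)}. -/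
open scoped ENNReal

theorem card_nonConsecPair_ge (k : ℕ) (hk : 1 ≤ k) :
    (k : ℝ) ^ 2 / 2 - 3 * (k : ℝ) / 2 + 1 ≤ (Fintype.card (NonConsecPair k) : ℝ) := by
  obtain ⟨K, rfl⟩ : ∃ K, k = K + 1 := ⟨k - 1, by omega⟩
  let g : (Σ j : Fin K, Fin j.val) → NonConsecPair (K + 1) := fun x =>
    ⟨(⟨x.2.val, by have := x.1.isLt; have := x.2.isLt; omega⟩,
      ⟨x.1.val + 1, by have := x.1.isLt; omega⟩), by
        have := x.2.isLt
        constructor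
        · show x.2.val < x.1.val + 1
          omega
        · show x.1.val + 1 ≠ x.2.val + 1
          omega⟩
  have hg : Function.Injective g := by
    rintro ⟨⟨j, hj⟩, ⟨i, hi⟩⟩ ⟨⟨j', hj'⟩, ⟨i', hi'⟩⟩ h
    simp only [g, Subtype.mk.injEq, Prod.mk.injEq, Fin.mk.injEq] at h
    obtain ⟨h1, h2⟩ := h
    have h3 : j = j' := by omega
    subst h1 h3
    rfl
  have h := Fintype.card_le_of_injective g hg
  rw [Fintype.card_sigma] at h
  simp only [Fintype.card_fin] at h
  rw [Fin.sum_univ_eq_sum_range (fun i => i) K] at h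
  have h2 : ∀ K : ℕ, ((∑ i ∈ Finset.range K, i : ℕ) : ℝ) * 2 = K * (K - 1) := by
    intro K
    induction K with
    | zero => simp
    | succ K ih =>
      rw [Finset.sum_range_succ]
      push_cast at ih ⊢
      linarith
  have h3 : ((∑ i ∈ Finset.range K, i : ℕ) : ℝ) ≤ (Fintype.card (NonConsecPair (K + 1)) : ℝ) := by
    exact_mod_cast h
  have h4 := h2 K
  push_cast at h3 h4 ⊢
  nlinarith

/-- Theorem 1 of the paper: if `k ≥ (2+δ) log₂ n`, then for a graph `G'` on `n` vertices
and a fixed pattern `s` on the non-consecutive pairs of `Fin k`, the probability over a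
uniformly random assignment `w` of Booleans to the non-consecutive pairs that some
injective `f : Fin k → V` realizes the watermark is at most
`2^{-(δk²/(2(2+δ)) - 3k/2 + 1)}`. -/
theorem watermark_uniqueness (δ : ℝ) (hδ : 0 < δ) (n k : ℕ) (hn : 2 ≤ n) (hk : 2 ≤ k)
    (hkn : (k : ℝ) ≥ (2 + δ) * Real.logb 2 n)
    (V : Type) [Fintype V] (hV : Fintype.card V = n)
    (G' : SimpleGraph V) (s : NonConsecPair k → Bool) :
    (PMF.uniformOfFintype (NonConsecPair k → Bool)).toOuterMeasure
      {w | ∃ f : Fin k → V, Function.Injective f ∧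
        (∀ p : NonConsecPair k,
          G'.Adj (f p.val.1) (f p.val.2) ↔ xor (s p) (w p) = true) ∧
        (∀ i : ℕ, (h : i + 1 < k) →
          G'.Adj (f ⟨i, Nat.lt_of_succ_lt h⟩) (f ⟨i + 1, h⟩))}
      ≤ (2 : ℝ≥0∞) ^ (-(δ * (k : ℝ) ^ 2 / (2 * (2 + δ)) - 3 * (k : ℝ) / 2 + 1)) := by
  classical
  let W : (Fin k → V) → (NonConsecPair k → Bool) := fun f p =>
    xor (s p) (decide (G'.Adj (f p.val.1) (f p.val.2)))
  let T : Finset (NonConsecPair k → Bool) := Finset.univ.image W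
  have hT : T.card ≤ n ^ k := by
    refine Finset.card_image_le.trans ?_
    simp [hV]
  have hcard := card_nonConsecPair_ge k (by omega)
  set m := Fintype.card (NonConsecPair k) with hm
  have hsub : {w : NonConsecPair k → Bool | ∃ f : Fin k → V, Function.Injective f ∧
        (∀ p : NonConsecPair k,
          G'.Adj (f p.val.1) (f p.val.2) ↔ xor (s p) (w p) = true) ∧
        (∀ i : ℕ, (h : i + 1 < k) →
          G'.Adj (f ⟨i, Nat.lt_of_succ_lt h⟩) (f ⟨i + 1, h⟩))} ⊆ (T : Set _) := by
    rintro w ⟨f, -, hf, -⟩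
    refine Finset.mem_coe.2 (Finset.mem_image.2 ⟨f, Finset.mem_univ _, ?_⟩)
    funext p
    have hd : decide (G'.Adj (f p.val.1) (f p.val.2)) = xor (s p) (w p) := by
      rw [Bool.eq_iff_iff, decide_eq_true_iff]
      exact hf p
    show xor (s p) (decide (G'.Adj (f p.val.1) (f p.val.2))) = w p
    rw [hd]
    cases s p <;> cases w p <;> rfl
  refine (MeasureTheory.measure_mono hsub).trans ?_
  rw [PMF.toOuterMeasure_uniformOfFintype_apply]
  have hden : Fintype.card (NonConsecPair k → Bool) = 2 ^ m := by
    rw [Fintype.card_fun, Fintype.card_bool]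
  have hnum : Fintype.card ((T : Set (NonConsecPair k → Bool)) : Type) = T.card := by
    simp
  have hn0 : (0 : ℝ) < n := by exact_mod_cast (by omega : 0 < n)
  have hk0 : (0 : ℝ) ≤ k := Nat.cast_nonneg k
  have hlog : Real.logb 2 n ≤ k / (2 + δ) := by
    rw [le_div_iff₀ (by linarith)]
    linarith
  have hnle : (n : ℝ≥0∞) ^ k ≤ (2 : ℝ≥0∞) ^ ((k : ℝ) / (2 + δ) * k) := by
    rw [ENNReal.rpow_mul, ENNReal.rpow_natCast]
    gcongr
    have h1 : (n : ℝ) ≤ (2 : ℝ) ^ ((k : ℝ) / (2 + δ)) :=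
      (Real.logb_le_iff_le_rpow (by norm_num) hn0).1 hlog
    have h2 := ENNReal.ofReal_le_ofReal h1
    rw [ENNReal.ofReal_natCast, ← ENNReal.ofReal_rpow_of_pos (by norm_num)] at h2
    simpa using h2
  have hT' : (T.card : ℝ≥0∞) ≤ (n : ℝ≥0∞) ^ k := by exact_mod_cast hT
  calc _ = (T.card : ℝ≥0∞) / (2 : ℝ≥0∞) ^ (m : ℝ) := by
        rw [hden, ENNReal.rpow_natCast]
        push_cast
        congr 2
    _ ≤ (2 : ℝ≥0∞) ^ ((k : ℝ) / (2 + δ) * k) / (2 : ℝ≥0∞) ^ (m : ℝ) := by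
        gcongr
        exact hT'.trans hnle
    _ = (2 : ℝ≥0∞) ^ ((k : ℝ) / (2 + δ) * k - m) :=
        (ENNReal.rpow_sub _ _ (by norm_num) (by norm_num)).symm
    _ ≤ _ := by
        apply ENNReal.rpow_le_rpow_of_exponent_le (by norm_num)
        have h5 : δ * (k : ℝ) ^ 2 / (2 * (2 + δ)) = (k : ℝ) ^ 2 / 2 - (k : ℝ) / (2 + δ) * k := by
          have : (2 + δ) ≠ 0 := by linarith
          field_simp
          ring
        rw [h5]
        linarith
end
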